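/- arXiv:cs/0510002 — 2 statements merged into one kernel-verified Lean document; each statement's English description precedes it below -/
import Mathlib

section
/- Let P > 0 and P_R > 0, let x be a real random variable uniform on {+√P, −√P} (BPSK), let n be a standard real Gaussian random variable independent of x, and set ε = Pr[n > √P] (so 0 < ε < 1/2). For the demodulate-and-forward relay function f(x + n) = √P_R · sign(x + n), the uncorrelated error e_u = (P / E[x·f(x+n)])·f(x+n) − x satisfies E[e_u²] = 4·P·ε·(1 − ε) / (1 − 2ε)². -/
open MeasureTheory ProbabilityTheory

theorem Real.measurable_sign : Measurable Real.sign := by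
  unfold Real.sign
  exact Measurable.ite measurableSet_Iio measurable_const
    (Measurable.ite measurableSet_Ioi measurable_const measurable_const)

theorem comp_sign_add_ae_eq (γ : Measure ℝ) [NullSingletonClass γ] (a : ℝ) (φ : ℝ → ℝ) :
    (fun t => φ (Real.sign (a + t))) =ᵐ[γ]
      fun t => (Set.Ioi (-a)).indicator (fun _ => φ 1 - φ (-1)) t + φ (-1) := by
  filter_upwards [Measure.ae_ne γ (-a)] with t ht
  rcases lt_or_gt_of_ne ht with h | h
  · rw [Real.sign_of_neg (by linarith), Set.indicator_of_notMem (by simpa using h.le)]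
    ring
  · rw [Real.sign_of_pos (by linarith), Set.indicator_of_mem (by simpa using h)]
    ring

theorem integrable_comp_sign_add (γ : Measure ℝ) [IsProbabilityMeasure γ] [NullSingletonClass γ]
    (a : ℝ) (φ : ℝ → ℝ) : Integrable (fun t => φ (Real.sign (a + t))) γ :=
  (((integrable_const _).indicator measurableSet_Ioi).add (integrable_const _)).congr
    (comp_sign_add_ae_eq γ a φ).symm

theorem integral_comp_sign_add (γ : Measure ℝ) [IsProbabilityMeasure γ] [NullSingletonClass γ]
    (a : ℝ) (φ : ℝ → ℝ) :
    ∫ t, φ (Real.sign (a + t)) ∂γ =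
      γ.real (Set.Ioi (-a)) * φ 1 + (1 - γ.real (Set.Ioi (-a))) * φ (-1) := by
  rw [integral_congr_ae (comp_sign_add_ae_eq γ a φ),
    integral_add ((integrable_const _).indicator measurableSet_Ioi) (integrable_const _),
    integral_indicator_const _ measurableSet_Ioi]
  simp
  ring

theorem gaussianReal_Ioi_neg (s : ℝ) :
    (gaussianReal 0 1).real (Set.Ioi (-s)) = 1 - (gaussianReal 0 1).real (Set.Ioi s) := by
  have : NullSingletonClass (gaussianReal 0 1) := nullSingletonClass_gaussianReal one_ne_zero
  have h : (gaussianReal 0 1).real (Set.Iio (-s)) = (gaussianReal 0 1).real (Set.Ioi s) := by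
    have hm : (gaussianReal 0 1).map (fun y => -y) = gaussianReal 0 1 := by
      simp [gaussianReal_map_neg]
    conv_lhs => rw [← hm]
    rw [map_measureReal_apply measurable_neg measurableSet_Iio]
    congr 1
    ext y
    simp
  rw [← h, ← probReal_compl_eq_one_sub measurableSet_Iio, Set.compl_Iio]
  exact measureReal_congr Ioi_ae_eq_Ici

theorem gaussianReal_Ioi_lt_half {s : ℝ} (hs : 0 < s) :
    (gaussianReal 0 1).real (Set.Ioi s) < 1 / 2 := by
  have hpos : 0 < (gaussianReal 0 1).real (Set.Ioc (-s) s) := by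
    rw [measureReal_def, ENNReal.toReal_pos_iff]
    refine ⟨pos_iff_ne_zero.2 fun h => ?_, measure_lt_top _ _⟩
    have := gaussianReal_absolutelyContinuous' 0 one_ne_zero h
    rw [Real.volume_Ioc, ENNReal.ofReal_eq_zero] at this
    linarith
  have hunion := measureReal_union (μ := gaussianReal 0 1) (s₁ := Set.Ioc (-s) s)
    (s₂ := Set.Ioi s) (Set.disjoint_left.2 fun y hy hy' => not_lt.2 hy.2 hy') measurableSet_Ioi
  rw [Set.Ioc_union_Ioi_eq_Ioi (by linarith), gaussianReal_Ioi_neg] at hunion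
  linarith

theorem integral_two_point_prod {γ : Measure ℝ} [IsProbabilityMeasure γ] (a b : ℝ)
    {F : ℝ × ℝ → ℝ} (hF : Measurable F) (ha : Integrable (fun t => F (a, t)) γ)
    (hb : Integrable (fun t => F (b, t)) γ) :
    ∫ p, F p ∂(((1 / 2 : ENNReal) • Measure.dirac a + (1 / 2 : ENNReal) • Measure.dirac b).prod γ)
      = (1 / 2) * ∫ t, F (a, t) ∂γ + (1 / 2) * ∫ t, F (b, t) ∂γ := by
  have hmk (c : ℝ) : Measurable (Prod.mk c : ℝ → ℝ × ℝ) := measurable_prodMk_left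
  have hint {c : ℝ} (hc : Integrable (fun t => F (c, t)) γ) :
      Integrable F ((1 / 2 : ENNReal) • γ.map (Prod.mk c)) :=
    ((integrable_map_measure hF.aestronglyMeasurable (hmk c).aemeasurable).2 hc).smul_measure
      (by simp)
  rw [Measure.add_prod, Measure.prod_smul_left, Measure.prod_smul_left, Measure.dirac_prod,
    Measure.dirac_prod, integral_add_measure (hint ha) (hint hb), integral_smul_measure,
    integral_smul_measure, integral_map (hmk a).aemeasurable hF.aestronglyMeasurable,
    integral_map (hmk b).aemeasurable hF.aestronglyMeasurable]
  simp

/-- The joint law of a BPSK symbol and its hard decision after additive standard Gaussian noise. -/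
theorem integral_bpsk_sign {Ω : Type*} [MeasurableSpace Ω] {μ : Measure Ω}
    [IsProbabilityMeasure μ] {s : ℝ} {x n : Ω → ℝ} (hx : Measurable x) (hn : Measurable n)
    (hxlaw : μ.map x =
      (1 / 2 : ENNReal) • Measure.dirac s + (1 / 2 : ENNReal) • Measure.dirac (-s))
    (hnlaw : μ.map n = gaussianReal 0 1) (hindep : IndepFun x n μ)
    {ε : ℝ} (hε : ε = (gaussianReal 0 1).real (Set.Ioi s))
    {g : ℝ → ℝ → ℝ} (hg : Measurable (Function.uncurry g)) :
    ∫ ω, g (x ω) (Real.sign (x ω + n ω)) ∂μ =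
      (1 / 2) * ((1 - ε) * g s 1 + ε * g s (-1)) +
        (1 / 2) * (ε * g (-s) 1 + (1 - ε) * g (-s) (-1)) := by
  have : NullSingletonClass (gaussianReal 0 1) := nullSingletonClass_gaussianReal one_ne_zero
  have hF : Measurable fun p : ℝ × ℝ => g p.1 (Real.sign (p.1 + p.2)) :=
    hg.comp (measurable_fst.prodMk
      (Real.measurable_sign.comp (measurable_fst.add measurable_snd)))
  have hjoint : μ.map (fun ω => (x ω, n ω)) = (μ.map x).prod (μ.map n) :=
    (indepFun_iff_map_prod_eq_prod_map_map hx.aemeasurable hn.aemeasurable).1 hindep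
  rw [← integral_map (φ := fun ω => (x ω, n ω)) (hx.prodMk hn).aemeasurable
    hF.aestronglyMeasurable, hjoint, hxlaw, hnlaw,
    integral_two_point_prod s (-s) hF (integrable_comp_sign_add _ s (g s))
      (integrable_comp_sign_add _ (-s) (g (-s))),
    integral_comp_sign_add _ s (g s), integral_comp_sign_add _ (-s) (g (-s)), neg_neg,
    gaussianReal_Ioi_neg, ← hε]
  ring

/-- For BPSK and the demodulate-and-forward relay function `f(x+n) = √P_R ⬝ sign(x+n)`,
the uncorrelated error `e_u = (P/E[x⬝f(x+n)])⬝f(x+n) − x` has power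
`4⬝P⬝ε⬝(1−ε)/(1−2ε)²`, where `ε = Pr[n > √P]`. -/
theorem df_msuee_bpsk
    {Ω : Type*} [MeasurableSpace Ω] (μ : Measure Ω) [IsProbabilityMeasure μ]
    (P P_R : ℝ) (hP : 0 < P) (hPR : 0 < P_R)
    (x n : Ω → ℝ) (hx : Measurable x) (hn : Measurable n)
    (hxlaw : μ.map x =
      (1 / 2 : ENNReal) • Measure.dirac (Real.sqrt P) +
        (1 / 2 : ENNReal) • Measure.dirac (-Real.sqrt P))
    (hnlaw : μ.map n = gaussianReal 0 1)
    (hindep : IndepFun x n μ)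
    (ε : ℝ) (hε : ε = (μ {ω | Real.sqrt P < n ω}).toReal) :
    ∫ ω, ((P / ∫ ω', x ω' * (Real.sqrt P_R * Real.sign (x ω' + n ω')) ∂μ) *
          (Real.sqrt P_R * Real.sign (x ω + n ω)) - x ω) ^ 2 ∂μ =
      4 * P * ε * (1 - ε) / (1 - 2 * ε) ^ 2 := by
  have hs : 0 < Real.sqrt P := Real.sqrt_pos.2 hP
  have hr : 0 < Real.sqrt P_R := Real.sqrt_pos.2 hPR
  have hsq : Real.sqrt P ^ 2 = P := Real.sq_sqrt hP.le
  have hε' : ε = (gaussianReal 0 1).real (Set.Ioi (Real.sqrt P)) := by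
    rw [hε, ← hnlaw, map_measureReal_apply hn measurableSet_Ioi]
    rfl
  have hlt : ε < 1 / 2 := hε' ▸ gaussianReal_Ioi_lt_half hs
  have hcorr : ∫ ω, x ω * (Real.sqrt P_R * Real.sign (x ω + n ω)) ∂μ =
      Real.sqrt P * Real.sqrt P_R * (1 - 2 * ε) := by
    rw [integral_bpsk_sign hx hn hxlaw hnlaw hindep hε'
      (g := fun u v => u * (Real.sqrt P_R * v)) (by unfold Function.uncurry; fun_prop)]
    ring
  rw [hcorr, integral_bpsk_sign hx hn hxlaw hnlaw hindep hε'
    (g := fun u v => (P / (Real.sqrt P * Real.sqrt P_R * (1 - 2 * ε)) *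
      (Real.sqrt P_R * v) - u) ^ 2) (by unfold Function.uncurry; fun_prop)]
  have hne : 1 - 2 * ε ≠ 0 := by linarith
  have hscale : P / (Real.sqrt P * Real.sqrt P_R * (1 - 2 * ε)) * Real.sqrt P_R =
      Real.sqrt P / (1 - 2 * ε) := by
    field_simp
    exact hsq.symm
  simp only [← mul_assoc, hscale]
  rw [show 4 * P * ε * (1 - ε) = 4 * Real.sqrt P ^ 2 * ε * (1 - ε) by rw [hsq]]
  field_simp
  ring
end

section
/- Let ε(P) = Pr[Z > √P] for Z a standard real Gaussian random variable (i.e. ε(P) = Q(√P)). Then the mean squared uncorrelated error of demodulate-and-forward for BPSK, MSUEE_DF(P) = 4·P·ε(P)·(1 − ε(P)) / (1 − 2·ε(P))², tends to π/2 as P → 0⁺. -/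
open MeasureTheory ProbabilityTheory Filter

lemma gaussianReal_Ioi_toReal_eq_integral (t : ℝ) :
    (gaussianReal 0 1 (Set.Ioi t)).toReal = ∫ x in Set.Ioi t, gaussianPDFReal 0 1 x := by
  rw [gaussianReal_apply_eq_integral 0 one_ne_zero, ENNReal.toReal_ofReal]
  exact integral_nonneg (gaussianPDFReal_nonneg 0 1)

lemma gaussianPDFReal_zero_one_eq (x : ℝ) :
    gaussianPDFReal 0 1 x = (√(2 * Real.pi))⁻¹ * Real.exp (-(1 / 2) * x ^ 2) := by
  rw [gaussianPDFReal]
  congr 2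
  · simp
  · simp
    ring

lemma gaussianReal_Ioi_zero_toReal : (gaussianReal 0 1 (Set.Ioi 0)).toReal = 1 / 2 := by
  rw [gaussianReal_Ioi_toReal_eq_integral]
  simp_rw [gaussianPDFReal_zero_one_eq]
  rw [integral_const_mul, integral_gaussian_Ioi, show Real.pi / (1 / 2) = 2 * Real.pi by ring]
  have : √(2 * Real.pi) ≠ 0 := by positivity
  field_simp

lemma hasDerivAt_gaussianReal_Ioi_toReal (t : ℝ) :
    HasDerivAt (fun t => (gaussianReal 0 1 (Set.Ioi t)).toReal) (-gaussianPDFReal 0 1 t) t := by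
  have hint : Integrable (gaussianPDFReal 0 1) := integrable_gaussianPDFReal 0 1
  have hcont : Continuous (gaussianPDFReal 0 1) := by
    rw [gaussianPDFReal_def]
    fun_prop
  have heq : (fun t => (gaussianReal 0 1 (Set.Ioi t)).toReal) = fun t =>
      (∫ x in Set.Ioi 0, gaussianPDFReal 0 1 x) - ∫ x in 0..t, gaussianPDFReal 0 1 x := by
    ext t
    rw [gaussianReal_Ioi_toReal_eq_integral,
      ← intervalIntegral.integral_Ioi_sub_Ioi' hint.integrableOn hint.integrableOn, sub_sub_cancel]
  rw [heq]
  exact (hcont.integral_hasStrictDerivAt 0 t).hasDerivAt.const_sub _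

lemma tendsto_one_sub_two_mul_gaussianReal_Ioi_div :
    Tendsto (fun t => (1 - 2 * (gaussianReal 0 1 (Set.Ioi t)).toReal) / t)
      (nhdsWithin 0 (Set.Ioi 0)) (nhds (2 * (√(2 * Real.pi))⁻¹)) := by
  have h := ((hasDerivAt_gaussianReal_Ioi_toReal 0).const_mul 2).const_sub 1
  have h' := h.tendsto_slope_zero_right
  rw [gaussianPDFReal_zero_one_eq] at h'
  simp only [zero_add, gaussianReal_Ioi_zero_toReal, smul_eq_mul] at h'
  convert h' using 2
  · ring
  · simp

/-- The mean squared uncorrelated error of demodulate-and-forward for BPSK,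
`MSUEE_DF(P) = 4⬝P⬝ε(P)⬝(1−ε(P))/(1−2⬝ε(P))²` with `ε(P) = Q(√P)`, tends to `π/2`
as the source power `P → 0⁺`. -/
theorem df_msuee_tendsto_pi_div_two :
    Tendsto
      (fun P : ℝ =>
        4 * P * (gaussianReal 0 1 (Set.Ioi (Real.sqrt P))).toReal *
            (1 - (gaussianReal 0 1 (Set.Ioi (Real.sqrt P))).toReal) /
          (1 - 2 * (gaussianReal 0 1 (Set.Ioi (Real.sqrt P))).toReal) ^ 2)
      (nhdsWithin 0 (Set.Ioi 0)) (nhds (Real.pi / 2)) := by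
  have hsqrt : Tendsto Real.sqrt (nhdsWithin 0 (Set.Ioi 0)) (nhdsWithin 0 (Set.Ioi 0)) := by
    refine tendsto_nhdsWithin_iff.2 ⟨?_, ?_⟩
    · simpa using (Real.continuous_sqrt.tendsto 0).mono_left nhdsWithin_le_nhds
    · filter_upwards [self_mem_nhdsWithin] with P hP using Real.sqrt_pos.2 hP
  have hQ : Tendsto (fun t => (gaussianReal 0 1 (Set.Ioi t)).toReal)
      (nhdsWithin 0 (Set.Ioi 0)) (nhds (1 / 2)) := by
    rw [← gaussianReal_Ioi_zero_toReal]
    exact (hasDerivAt_gaussianReal_Ioi_toReal 0).continuousAt.tendsto.mono_left nhdsWithin_le_nhds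
  have hne : (2 * (√(2 * Real.pi))⁻¹) ^ 2 ≠ 0 := by positivity
  have hlim := (((hQ.const_mul 4).mul (hQ.const_sub 1)).div
    (tendsto_one_sub_two_mul_gaussianReal_Ioi_div.pow 2) hne).comp hsqrt
  have hval : 4 * (1 / 2) * (1 - 1 / 2) / (2 * (√(2 * Real.pi))⁻¹) ^ 2 = Real.pi / 2 := by
    rw [mul_pow, inv_pow, Real.sq_sqrt (by positivity)]
    field_simp
    norm_num
  rw [hval] at hlim
  refine hlim.congr' ?_
  filter_upwards [self_mem_nhdsWithin] with P hP
  simp only [Function.comp_apply, Pi.div_apply]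
  rw [div_pow, Real.sq_sqrt (le_of_lt hP), div_div_eq_mul_div]
  ring
end
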